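/- arXiv:2401.13933 — 2 statements merged into one kernel-verified Lean document; each statement's English description precedes it below -/
import Mathlib

section
/- Assume n ≥ 2 (so that F' is a proper subfield). Let d ∈ F[α_1,…,α_n] be an irreducible polynomial with deg_{α_n}(d) ≥ 1 that is not a scalar multiple of α_n (equivalently, d is not σ-equivalent to α_n), and suppose Spr_σ(d,d) = {0}. Let j ≥ 1, c ∈ F∖{0}, and let a ∈ F'[α_n] be a polynomial in α_n with coefficients in F' satisfying deg_{α_n}(a) < deg_{α_n}(d). Then a/d^j is cσ-summable in K if and only if a = 0. -/
open MvPolynomial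

/-- `K F n` is the rational function field `F(α₁,…,αₙ)`. -/
abbrev K (F : Type*) [Field F] (n : ℕ) := FractionRing (MvPolynomial (Fin n) F)

/-- The canonical image of the variable `αᵢ` in `K F n`. -/
noncomputable def α {F : Type*} [Field F] {n : ℕ} (i : Fin n) : K F n :=
  algebraMap (MvPolynomial (Fin n) F) (K F n) (X i)

/-- `F' = F(α₁,…,α_{n−1})`, realized as the subfield of `K F (n+1)` generated by (the image
of) `F` together with all the variables except the last one. -/
noncomputable def Fprime (F : Type*) [Field F] (n : ℕ) : Subfield (K F (n + 1)) :=
  Subfield.closure (Set.range (algebraMap F (K F (n + 1))) ∪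
    Set.range fun t : Fin n => (α t.castSucc : K F (n + 1)))

namespace Stmt11

/-- rescaling of the variables -/
noncomputable def scale {F : Type*} [Field F] {n : ℕ} (l : Fin n → F) :
    MvPolynomial (Fin n) F →ₐ[F] MvPolynomial (Fin n) F :=
  aeval fun i => C (l i) * X i

theorem scale_X {F : Type*} [Field F] {n : ℕ} (l : Fin n → F) (i : Fin n) :
    scale l (X i) = C (l i) * X i := by simp [scale]

theorem coeff_scale {F : Type*} [Field F] {n : ℕ} (l : Fin n → F) (p : MvPolynomial (Fin n) F)
    (m : Fin n →₀ ℕ) : coeff m (scale l p) = (∏ i, l i ^ m i) * coeff m p := by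
  classical
  induction p using MvPolynomial.induction_on' with
  | monomial u r =>
    have : scale l (monomial u r) = monomial u ((∏ i, l i ^ u i) * r) := by
      rw [scale, aeval_monomial, Finsupp.prod_fintype _ _ (by simp)]
      simp only [mul_pow, Finset.prod_mul_distrib, algebraMap_eq]
      rw [monomial_eq (s := u), Finsupp.prod_fintype _ _ (by simp)]
      simp only [map_mul, map_prod, map_pow]
      ring
    rw [this, coeff_monomial, coeff_monomial]
    split_ifs with h
    · rw [h]
    · simp
  | add p q hp hq => simp [hp, hq, mul_add]

theorem degreeOf_scale_le {F : Type*} [Field F] {n : ℕ} (l : Fin n → F)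
    (p : MvPolynomial (Fin n) F) (i : Fin n) : degreeOf i (scale l p) ≤ degreeOf i p := by
  rw [degreeOf_eq_sup, degreeOf_eq_sup]
  apply Finset.sup_mono
  intro m hm
  rw [mem_support_iff, coeff_scale] at hm
  exact mem_support_iff.2 (right_ne_zero_of_mul hm)

/-- rescaling as an equivalence -/
noncomputable def tau {F : Type*} [Field F] {n : ℕ} (l : Fin n → F) (hl : ∀ i, l i ≠ 0) :
    MvPolynomial (Fin n) F ≃ₐ[F] MvPolynomial (Fin n) F :=
  AlgEquiv.ofAlgHom (scale l) (scale fun i => (l i)⁻¹)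
    (by
      ext1 i
      simp only [AlgHom.comp_apply, scale_X, map_mul, algHom_C, AlgHom.id_apply, algebraMap_eq]
      rw [← mul_assoc, ← C_mul, inv_mul_cancel₀ (hl i), C_1, one_mul])
    (by
      ext1 i
      simp only [AlgHom.comp_apply, scale_X, map_mul, algHom_C, AlgHom.id_apply, algebraMap_eq]
      rw [← mul_assoc, ← C_mul, mul_inv_cancel₀ (hl i), C_1, one_mul])

theorem degreeOf_tau {F : Type*} [Field F] {n : ℕ} (l : Fin n → F) (hl : ∀ i, l i ≠ 0)
    (p : MvPolynomial (Fin n) F) (i : Fin n) : degreeOf i (tau l hl p) = degreeOf i p := by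
  apply le_antisymm (degreeOf_scale_le l p i)
  have h : (tau l hl).symm (tau l hl p) = p := by simp
  conv_lhs => rw [← h]
  exact degreeOf_scale_le _ _ i

theorem degreeOf_tau_zpow {F : Type*} [Field F] {n : ℕ} (l : Fin n → F) (hl : ∀ i, l i ≠ 0)
    (i : Fin n) (k : ℤ) : ∀ (p : MvPolynomial (Fin n) F),
    degreeOf i ((tau l hl ^ k) p) = degreeOf i p := by
  induction k with
  | zero => intro p; simp
  | succ k ih => intro p; rw [zpow_add_one, AlgEquiv.mul_apply, ih, degreeOf_tau]
  | pred k ih =>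
    intro p
    rw [zpow_sub_one, AlgEquiv.mul_apply, ih, ← degreeOf_tau l hl, ← AlgEquiv.mul_apply,
      mul_inv_cancel, AlgEquiv.one_apply]

theorem sigma_eq {F : Type*} [Field F] {n : ℕ} (l : Fin n → F) (hl : ∀ i, l i ≠ 0)
    (σ : K F n ≃ₐ[F] K F n) (hσ : ∀ i, σ (α i) = algebraMap F (K F n) (l i) * α i)
    (p : MvPolynomial (Fin n) F) :
    σ (algebraMap _ (K F n) p) = algebraMap _ (K F n) (tau l hl p) := by
  have : (σ : K F n →ₐ[F] K F n).comp (IsScalarTower.toAlgHom F (MvPolynomial (Fin n) F) (K F n))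
      = (IsScalarTower.toAlgHom F (MvPolynomial (Fin n) F) (K F n)).comp (scale l) := by
    ext1 i
    simp only [AlgHom.comp_apply, scale_X, IsScalarTower.coe_toAlgHom', map_mul]
    have := hσ i
    rw [IsScalarTower.algebraMap_apply F (MvPolynomial (Fin n) F) (K F n)] at this
    exact this
  exact DFunLike.congr_fun this p

theorem sigma_zpow_eq {F : Type*} [Field F] {n : ℕ} (l : Fin n → F) (hl : ∀ i, l i ≠ 0)
    (σ : K F n ≃ₐ[F] K F n) (hσ : ∀ i, σ (α i) = algebraMap F (K F n) (l i) * α i)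
    (k : ℤ) : ∀ (p : MvPolynomial (Fin n) F),
    (σ ^ k) (algebraMap _ (K F n) p) = algebraMap _ (K F n) ((tau l hl ^ k) p) := by
  induction k with
  | zero => intro p; simp
  | succ k ih =>
    intro p
    rw [zpow_add_one, AlgEquiv.mul_apply, sigma_eq l hl σ hσ, ih, zpow_add_one, AlgEquiv.mul_apply]
  | pred k ih =>
    intro p
    have h : σ⁻¹ (algebraMap _ (K F n) p) = algebraMap _ (K F n) ((tau l hl)⁻¹ p) := by
      apply σ.injective
      rw [sigma_eq l hl σ hσ, ← AlgEquiv.mul_apply, ← AlgEquiv.mul_apply,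
        mul_inv_cancel, mul_inv_cancel, AlgEquiv.one_apply, AlgEquiv.one_apply]
    rw [zpow_sub_one, AlgEquiv.mul_apply, h, ih, zpow_sub_one, AlgEquiv.mul_apply]

/-- elements of the fraction field without pole at `p` -/
def Reg {F : Type*} [Field F] {n : ℕ} (p : MvPolynomial (Fin n) F) (x : K F n) : Prop :=
  ∃ r s : MvPolynomial (Fin n) F, ¬ p ∣ s ∧ x * algebraMap _ (K F n) s = algebraMap _ (K F n) r

theorem Reg.add {F : Type*} [Field F] {n : ℕ} {p : MvPolynomial (Fin n) F} (hp : Prime p)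
    {x y : K F n} (hx : Reg p x) (hy : Reg p y) : Reg p (x + y) := by
  obtain ⟨r, s, hs, h⟩ := hx
  obtain ⟨r', s', hs', h'⟩ := hy
  refine ⟨r * s' + r' * s, s * s', fun hd => (hp.dvd_or_dvd hd).elim hs hs', ?_⟩
  simp only [map_mul, map_add, ← h, ← h']
  ring

theorem Reg.smul {F : Type*} [Field F] {n : ℕ} {p : MvPolynomial (Fin n) F}
    {x : K F n} (c : F) (hx : Reg p x) : Reg p (algebraMap F (K F n) c * x) := by
  obtain ⟨r, s, hs, h⟩ := hx
  refine ⟨C c * r, s, hs, ?_⟩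
  rw [map_mul, ← h, IsScalarTower.algebraMap_apply F (MvPolynomial (Fin n) F) (K F n),
    algebraMap_eq]
  ring

theorem Reg.neg {F : Type*} [Field F] {n : ℕ} {p : MvPolynomial (Fin n) F}
    {x : K F n} (hx : Reg p x) : Reg p (-x) := by
  obtain ⟨r, s, hs, h⟩ := hx
  exact ⟨-r, s, hs, by rw [map_neg, ← h]; ring⟩

theorem reg_sigma {F : Type*} [Field F] {n : ℕ} (l : Fin n → F) (hl : ∀ i, l i ≠ 0)
    (σ : K F n ≃ₐ[F] K F n) (hσ : ∀ i, σ (α i) = algebraMap F (K F n) (l i) * α i)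
    (p : MvPolynomial (Fin n) F) (x : K F n) :
    Reg (tau l hl p) (σ x) ↔ Reg p x := by
  constructor
  · rintro ⟨r, s, hs, h⟩
    refine ⟨(tau l hl).symm r, (tau l hl).symm s, fun hd => hs ?_, ?_⟩
    · simpa using map_dvd (tau l hl) hd
    · apply σ.injective
      rw [map_mul, sigma_eq l hl σ hσ, sigma_eq l hl σ hσ]
      simpa using h
  · rintro ⟨r, s, hs, h⟩
    refine ⟨tau l hl r, tau l hl s, fun hd => hs ?_, ?_⟩
    · simpa using map_dvd (tau l hl).symm hd
    · rw [← sigma_eq l hl σ hσ, ← sigma_eq l hl σ hσ, ← map_mul, h]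

theorem fprime_rep {F : Type*} [Field F] {n : ℕ} (x : K F (n + 1)) (hx : x ∈ Fprime F n) :
    ∃ p q : MvPolynomial (Fin (n + 1)) F, degreeOf (Fin.last n) p = 0 ∧
      degreeOf (Fin.last n) q = 0 ∧ q ≠ 0 ∧
      x * algebraMap _ (K F (n + 1)) q = algebraMap _ (K F (n + 1)) p := by
  have hmul : ∀ p q : MvPolynomial (Fin (n + 1)) F, degreeOf (Fin.last n) p = 0 →
      degreeOf (Fin.last n) q = 0 → degreeOf (Fin.last n) (p * q) = 0 := by
    intro p q hp hq
    have := degreeOf_mul_le (Fin.last n) p q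
    omega
  unfold Fprime at hx
  induction hx using Subfield.closure_induction with
  | mem x hx =>
    rcases hx with ⟨c, rfl⟩ | ⟨t, rfl⟩
    · refine ⟨C c, 1, degreeOf_C _ _, degreeOf_one _, one_ne_zero, ?_⟩
      rw [IsScalarTower.algebraMap_apply F (MvPolynomial (Fin (n + 1)) F) (K F (n + 1)),
        algebraMap_eq]
      simp
    · refine ⟨X t.castSucc, 1, degreeOf_X_of_ne (Fin.castSucc_lt_last t).ne', degreeOf_one _,
        one_ne_zero, ?_⟩
      simp [α]
  | one => exact ⟨1, 1, degreeOf_one _, degreeOf_one _, one_ne_zero, by simp⟩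
  | add x y _ _ h h' =>
    obtain ⟨p, q, hp, hq, hq0, h⟩ := h
    obtain ⟨p', q', hp', hq', hq0', h'⟩ := h'
    refine ⟨p * q' + p' * q, q * q', ?_, hmul _ _ hq hq', mul_ne_zero hq0 hq0', ?_⟩
    · have h1 := degreeOf_add_le (Fin.last n) (p * q') (p' * q)
      rw [hmul _ _ hp hq', hmul _ _ hp' hq] at h1
      simpa using h1
    · simp only [map_mul, map_add, ← h, ← h']
      ring
  | neg x _ h =>
    obtain ⟨p, q, hp, hq, hq0, h⟩ := h
    exact ⟨-p, q, by rw [degreeOf_neg]; exact hp, hq, hq0, by rw [map_neg, ← h]; ring⟩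
  | inv x _ h =>
    obtain ⟨p, q, hp, hq, hq0, h⟩ := h
    by_cases hx : x = 0
    · exact ⟨0, 1, degreeOf_zero _, degreeOf_one _, one_ne_zero, by simp [hx]⟩
    · refine ⟨q, p, hq, hp, ?_, ?_⟩
      · rintro rfl
        rw [map_zero] at h
        rcases mul_eq_zero.1 h with h | h
        · exact hx h
        · exact hq0 ((FaithfulSMul.algebraMap_injective _ _) (h.trans (map_zero _).symm))
      · rw [← h, inv_mul_cancel_left₀ hx]
  | mul x y _ _ h h' =>
    obtain ⟨p, q, hp, hq, hq0, h⟩ := h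
    obtain ⟨p', q', hp', hq', hq0', h'⟩ := h'
    refine ⟨p * p', q * q', hmul _ _ hp hp', hmul _ _ hq hq', mul_ne_zero hq0 hq0', ?_⟩
    simp only [map_mul, ← h, ← h']
    ring

theorem sum_rep {F : Type*} [Field F] {n : ℕ} (aC : ℕ → K F (n + 1))
    (haC : ∀ t, aC t ∈ Fprime F n) (N : ℕ) :
    ∃ b e : MvPolynomial (Fin (n + 1)) F, degreeOf (Fin.last n) b ≤ N - 1 ∧
      degreeOf (Fin.last n) e = 0 ∧ e ≠ 0 ∧
      (∑ t ∈ Finset.range N, aC t * (α (Fin.last n) : K F (n + 1)) ^ t) *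
        algebraMap _ (K F (n + 1)) e = algebraMap _ (K F (n + 1)) b := by
  induction N with
  | zero => exact ⟨0, 1, by simp, degreeOf_one _, one_ne_zero, by simp⟩
  | succ N ih =>
    obtain ⟨b, e, hb, he, he0, h⟩ := ih
    obtain ⟨p, q, hp, hq, hq0, h'⟩ := fprime_rep _ (haC N)
    refine ⟨b * q + e * p * X (Fin.last n) ^ N, e * q, ?_, ?_, mul_ne_zero he0 hq0, ?_⟩
    · have h1 := degreeOf_add_le (Fin.last n) (b * q) (e * p * X (Fin.last n) ^ N)
      have h2 := degreeOf_mul_le (Fin.last n) b q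
      have h3 := degreeOf_mul_le (Fin.last n) (e * p) (X (Fin.last n) ^ N)
      have h4 := degreeOf_mul_le (Fin.last n) e p
      rw [degreeOf_X_self_pow] at h3
      omega
    · have h2 := degreeOf_mul_le (Fin.last n) e q
      omega
    · rw [Finset.sum_range_succ]
      simp only [map_mul, map_add, map_pow, ← h, ← h', α]
      ring

theorem not_dvd_of_degreeOf_lt {F : Type*} [Field F] {n : ℕ} {i : Fin n}
    {p q : MvPolynomial (Fin n) F} (hq : q ≠ 0) (h : degreeOf i q < degreeOf i p) : ¬ p ∣ q := by
  rintro ⟨r, rfl⟩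
  rw [degreeOf_mul_eq (left_ne_zero_of_mul hq) (right_ne_zero_of_mul hq)] at h
  omega

/-- Only finitely many pairwise nonassociated irreducibles of positive degree are poles. -/
theorem exists_reg {F : Type*} [Field F] {n : ℕ} (i : Fin n) (π : ℕ → MvPolynomial (Fin n) F)
    (hirr : ∀ k, Irreducible (π k)) (hdeg : ∀ k, 1 ≤ degreeOf i (π k))
    (hna : ∀ k m, k ≠ m → ¬ π k ∣ π m) (g : K F n) : ∃ k, Reg (π k) g := by
  by_contra hcon
  push Not at hcon
  obtain ⟨r, s, hs, rfl⟩ := IsFractionRing.div_surjective (A := MvPolynomial (Fin n) F) g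
  have hs0 : s ≠ 0 := nonZeroDivisors.ne_zero hs
  have hdvd : ∀ k, π k ∣ s := by
    intro k
    by_contra hk
    apply hcon k
    refine ⟨r, s, hk, div_mul_cancel₀ _ ?_⟩
    intro h
    exact hs0 ((FaithfulSMul.algebraMap_injective _ (K F n)) (h.trans (map_zero _).symm))
  have hprod : ∏ k ∈ Finset.range (degreeOf i s + 1), π k ∣ s := by
    apply Finset.prod_dvd_of_isRelPrime
    · intro k _ m _ hkm
      exact (hirr k).isRelPrime_iff_not_dvd.2 (hna k m hkm)
    · intro k _
      exact hdvd k
  refine not_dvd_of_degreeOf_lt (i := i) hs0 ?_ hprod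
  rw [degreeOf_prod_eq _ _ (fun k _ => (hirr k).ne_zero)]
  calc degreeOf i s < ∑ k ∈ Finset.range (degreeOf i s + 1), 1 := by simp
    _ ≤ _ := Finset.sum_le_sum fun k _ => hdeg k

end Stmt11

/-- Let `n + 1 ≥ 2` be the number of variables and `σ` the `F`-algebra
automorphism of `K = F(α₁,…,α_{n+1})` with `σ(αᵢ) = λᵢ αᵢ` (all `λᵢ` nonzero). Let `d` be an
irreducible polynomial with `deg_{αlast}(d) ≥ 1` which is not a scalar multiple of the last
variable, and with trivial spread set `Spr_σ(d,d) = {0}`. Let `j ≥ 1`, `c ∈ F∖{0}`, and let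
`a = ∑_{t < deg_{αlast}(d)} aC(t)·αlast^t` be a polynomial in `αlast` with coefficients in
`F'` of degree `< deg_{αlast}(d)`. Then `a/d^j` is `cσ`-summable in `K` iff `a = 0`. -/
theorem stmt_11 {F : Type*} [Field F] [Algebra F (AlgebraicClosure ℚ)]
    {n : ℕ} (hn : 1 ≤ n)
    (lam : Fin (n + 1) → F) (hlam : ∀ i, lam i ≠ 0)
    (σ : K F (n + 1) ≃ₐ[F] K F (n + 1))
    (hσ : ∀ i, σ (α i) = algebraMap F (K F (n + 1)) (lam i) * α i)
    (d : MvPolynomial (Fin (n + 1)) F) (hirr : Irreducible d)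
    (hdeg : 1 ≤ d.degreeOf (Fin.last n))
    (hnotX : ¬ ∃ e : F, d = C e * X (Fin.last n))
    (hspr : {k : ℤ | ∃ e : F, e ≠ 0 ∧
        (σ ^ k) (algebraMap (MvPolynomial (Fin (n + 1)) F) (K F (n + 1)) d) =
          algebraMap F (K F (n + 1)) e *
            algebraMap (MvPolynomial (Fin (n + 1)) F) (K F (n + 1)) d} = {0})
    (j : ℕ) (hj : 1 ≤ j) (c : F) (hc : c ≠ 0)
    (aC : ℕ → K F (n + 1)) (haC : ∀ t, aC t ∈ Fprime F n)
    (a : K F (n + 1))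
    (ha : a = ∑ t ∈ Finset.range (d.degreeOf (Fin.last n)),
        aC t * (α (Fin.last n) : K F (n + 1)) ^ t) :
    (∃ g : K F (n + 1),
        a / (algebraMap (MvPolynomial (Fin (n + 1)) F) (K F (n + 1)) d) ^ j =
          algebraMap F (K F (n + 1)) c * σ g - g) ↔ a = 0 := by
  constructor
  swap
  · rintro h
    exact ⟨0, by simp [h]⟩
  rintro ⟨g, hg⟩
  by_contra ha0
  obtain ⟨b, e, hb, he, he0, hbe⟩ := Stmt11.sum_rep aC haC (d.degreeOf (Fin.last n))
  rw [← ha] at hbe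
  have hinj : Function.Injective (algebraMap (MvPolynomial (Fin (n + 1)) F) (K F (n + 1))) :=
    FaithfulSMul.algebraMap_injective _ _
  have hne : ∀ p : MvPolynomial (Fin (n + 1)) F, p ≠ 0 →
      algebraMap (MvPolynomial (Fin (n + 1)) F) (K F (n + 1)) p ≠ 0 := by
    intro p hp h
    exact hp (hinj (h.trans (map_zero _).symm))
  have hb0 : b ≠ 0 := by
    rintro rfl
    rw [map_zero] at hbe
    rcases mul_eq_zero.1 hbe with h | h
    · exact ha0 h
    · exact hne e he0 h
  set τ := Stmt11.tau lam hlam with hτ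
  have hpirr : ∀ k : ℤ, Irreducible ((τ ^ k) d) := fun k =>
    (MulEquiv.irreducible_iff (τ ^ k)).2 hirr
  have hpdeg : ∀ k : ℤ, degreeOf (Fin.last n) ((τ ^ k) d) = degreeOf (Fin.last n) d := fun k =>
    Stmt11.degreeOf_tau_zpow lam hlam _ k d
  have hpd : ∀ k : ℤ, (τ ^ k) d ∣ d → k = 0 := by
    intro k hk
    have hass := ((hpirr k).associated_of_dvd hirr hk).symm
    obtain ⟨u, hu⟩ := hass
    obtain ⟨r, hr, hur⟩ := isUnit_iff_eq_C_of_isReduced.1 u.isUnit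
    have : k ∈ ({0} : Set ℤ) := by
      rw [← hspr]
      refine ⟨r, hr.ne_zero, ?_⟩
      rw [Stmt11.sigma_zpow_eq lam hlam σ hσ, ← hτ, ← hu, hur, map_mul, mul_comm,
        IsScalarTower.algebraMap_apply F (MvPolynomial (Fin (n + 1)) F) (K F (n + 1)),
        algebraMap_eq]
    simpa using this
  have hpp : ∀ k m : ℤ, (τ ^ k) d ∣ (τ ^ m) d → k = m := by
    intro k m h
    have h2 := map_dvd (τ ^ (-m)) h
    rw [← AlgEquiv.mul_apply, ← AlgEquiv.mul_apply, ← zpow_add, ← zpow_add, neg_add_cancel,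
      zpow_zero, AlgEquiv.one_apply] at h2
    have := hpd _ h2
    omega
  have hstep : ∀ k : ℤ, Stmt11.Reg ((τ ^ (k + 1)) d) (σ g) ↔ Stmt11.Reg ((τ ^ k) d) g := by
    intro k
    rw [add_comm k 1, zpow_add, zpow_one, AlgEquiv.mul_apply]
    exact Stmt11.reg_sigma lam hlam σ hσ _ g
  set f := a / (algebraMap (MvPolynomial (Fin (n + 1)) F) (K F (n + 1)) d) ^ j with hf
  have hd0 := hne d hirr.ne_zero
  have hf0 : f * algebraMap (MvPolynomial (Fin (n + 1)) F) (K F (n + 1)) (d ^ j * e) =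
      algebraMap (MvPolynomial (Fin (n + 1)) F) (K F (n + 1)) b := by
    rw [hf, map_mul, map_pow, ← mul_assoc, div_mul_cancel₀ _ (pow_ne_zero _ hd0), hbe]
  have hfreg : ∀ k : ℤ, k ≠ 0 → Stmt11.Reg ((τ ^ k) d) f := by
    intro k hk
    refine ⟨b, d ^ j * e, ?_, hf0⟩
    intro h
    rcases (hpirr k).prime.dvd_or_dvd h with h | h
    · exact hk (hpd k ((hpirr k).prime.dvd_of_dvd_pow h))
    · exact Stmt11.not_dvd_of_degreeOf_lt (i := Fin.last n) he0 (by rw [hpdeg]; omega) h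
  have hfnot : ¬ Stmt11.Reg d f := by
    rintro ⟨r, s, hs, h⟩
    have h1 : b * s = r * (d ^ j * e) := by
      apply hinj
      rw [map_mul, map_mul _ r, ← h, ← hf0]
      ring
    have h2 : d ∣ b * s := by
      rw [h1]
      exact ((dvd_pow_self d (by omega)).mul_right e).mul_left r
    rcases hirr.prime.dvd_or_dvd h2 with h | h
    · exact Stmt11.not_dvd_of_degreeOf_lt (i := Fin.last n) hb0 (by omega) h
    · exact hs h
  have hgs : g = algebraMap F (K F (n + 1)) c * σ g + -f := by rw [hg]; ring
  have hc' : algebraMap F (K F (n + 1)) c ≠ 0 := by simpa using hc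
  have hsg : σ g = algebraMap F (K F (n + 1)) c⁻¹ * (f + g) := by
    rw [hg, map_inv₀]
    field_simp
    ring
  -- regularity propagates in both directions away from `0`
  have hdown : ∀ k : ℤ, k + 1 ≠ 0 →
      (Stmt11.Reg ((τ ^ (k + 1)) d) g ↔ Stmt11.Reg ((τ ^ k) d) g) := by
    intro k hk
    rw [← hstep k]
    constructor
    · intro h
      rw [hsg]
      exact ((hfreg _ hk).add (hpirr _).prime h).smul _
    · intro h
      rw [hgs]
      exact (h.smul _).add (hpirr _).prime (hfreg _ hk).neg
  have hpos : Stmt11.Reg d g := by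
    obtain ⟨k, hk⟩ := Stmt11.exists_reg (Fin.last n) (fun k : ℕ => (τ ^ (k : ℤ)) d)
      (fun k => hpirr _) (fun k => by rw [hpdeg]; exact hdeg)
      (fun k m hkm h => hkm (by exact_mod_cast hpp _ _ h)) g
    induction k with
    | zero => simpa using hk
    | succ k ih =>
      apply ih
      push_cast at hk
      exact (hdown k (by omega)).1 hk
  have hneg : Stmt11.Reg ((τ ^ (-1 : ℤ)) d) g := by
    obtain ⟨k, hk⟩ := Stmt11.exists_reg (Fin.last n) (fun k : ℕ => (τ ^ (-1 - (k : ℤ))) d)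
      (fun k => hpirr _) (fun k => by rw [hpdeg]; exact hdeg)
      (fun k m hkm h => hkm (by have := hpp _ _ h; omega)) g
    induction k with
    | zero => simpa using hk
    | succ k ih =>
      apply ih
      have h3 := (hdown (-1 - ((k + 1 : ℕ) : ℤ)) (by push_cast; omega)).2 hk
      have h4 : -1 - ((k + 1 : ℕ) : ℤ) + 1 = -1 - (k : ℤ) := by push_cast; ring
      rw [h4] at h3
      exact h3
  apply hfnot
  have hs : Stmt11.Reg d (σ g) := by
    have := (hstep (-1)).2 hneg
    simpa using this
  rw [hg, sub_eq_add_neg]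
  exact (hs.smul c).add hirr.prime hpos.neg
end

section
/- Assume n ≥ 2. Let d ∈ F[α_1,…,α_n] be an irreducible polynomial with deg_{α_n}(d) ≥ 1 that is not a scalar multiple of α_n (equivalently, not σ-equivalent to α_n). Suppose Spr_σ(d,d) = k·ℤ for some integer k ≥ 1 and σ^k(d) = u·d for some u ∈ F∖{0}. Let j ≥ 1, c ∈ F∖{0}, and let a ∈ F'[α_n] with deg_{α_n}(a) < deg_{α_n}(d). Set ε = c^k·u^{−j}. Then a/d^j is cσ-summable in K if and only if there exists b ∈ F'[α_n] with deg_{α_n}(b) < deg_{α_n}(d) such that a = ε·σ^k(b) − b. -/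
open MvPolynomial

section Generic

set_option linter.unusedSectionVars false

variable {A L : Type*} [CommRing A] [IsDomain A] [Field L]

lemma pseudoDiv (d : Polynomial A) (hd : 1 ≤ d.natDegree) : ∀ (m : ℕ) (p : Polynomial A),
    p.natDegree < m → ∃ (b : A) (Q S : Polynomial A), b ≠ 0 ∧ S.natDegree < d.natDegree ∧
      Polynomial.C b * p = d * Q + S := by
  intro m
  induction m with
  | zero => intro p hp; omega
  | succ m ih =>
    intro p hp
    by_cases h : p.natDegree < d.natDegree
    · exact ⟨1, 0, p, one_ne_zero, h, by simp⟩
    · have h1 : d.natDegree ≤ p.natDegree := by omega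
      have h2 := Polynomial.natDegree_cancelLeads_lt_of_natDegree_le_natDegree h1 (by omega)
      obtain ⟨b, Q, S, hb, hS, e⟩ := ih (d.cancelLeads p) (by omega)
      have hd0 : d ≠ 0 := by rintro rfl; simp at hd
      refine ⟨b * d.leadingCoeff, Q + Polynomial.C b *
          (Polynomial.C p.leadingCoeff * Polynomial.X ^ (p.natDegree - d.natDegree)), S,
        mul_ne_zero hb (Polynomial.leadingCoeff_ne_zero.2 hd0), hS, ?_⟩
      rw [Polynomial.cancelLeads, Nat.sub_eq_zero_of_le h1] at e
      simp only [pow_zero, mul_one] at e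
      rw [Polynomial.C_mul]
      linear_combination e

lemma bezoutConst (d : Polynomial A) (hd : Prime d) (hdeg : 1 ≤ d.natDegree) (q : Polynomial A)
    (hq : ¬ d ∣ q) : ∃ (b : A) (r s : Polynomial A), b ≠ 0 ∧ Polynomial.C b = q * r + d * s := by
  have hdom : IsDomain (AdjoinRoot d) := AdjoinRoot.isDomain_of_prime hd
  have hroot : IsAlgebraic A (AdjoinRoot.root d) := AdjoinRoot.isAlgebraic_root hd.ne_zero
  have halg : IsAlgebraic A (AdjoinRoot.mk d q) := by
    rw [← AdjoinRoot.aeval_eq]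
    have h1 : AdjoinRoot.root d ∈ Subalgebra.algebraicClosure A (AdjoinRoot d) := hroot
    have h2 := (Polynomial.aeval (⟨_, h1⟩ : Subalgebra.algebraicClosure A (AdjoinRoot d)) q).2
    rw [Polynomial.coe_aeval_mk_apply] at h2
    exact h2
  have hne : AdjoinRoot.mk d q ≠ 0 := by rwa [Ne, AdjoinRoot.mk_eq_zero]
  obtain ⟨b, hb, w, hw⟩ := halg.exists_nonzero_dvd (mem_nonZeroDivisors_of_ne_zero hne)
  obtain ⟨r, rfl⟩ := AdjoinRoot.mk_surjective w
  rw [AdjoinRoot.algebraMap_eq, ← AdjoinRoot.mk_C, ← map_mul, AdjoinRoot.mk_eq_mk] at hw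
  obtain ⟨s, hs⟩ := hw
  exact ⟨b, r, s, hb, by linear_combination hs⟩

/-- localisation at `d` -/
def Loc (ι : Polynomial A →+* L) (d : Polynomial A) (x : L) : Prop :=
  ∃ p q : Polynomial A, ¬ d ∣ q ∧ x = ι p / ι q

/-- polynomials of degree less than `deg d` over the fraction field of `A`. -/
def Low (ι : Polynomial A →+* L) (d : Polynomial A) (x : L) : Prop :=
  ∃ (p : Polynomial A) (b : A), b ≠ 0 ∧ p.natDegree < d.natDegree ∧ x = ι p / ι (Polynomial.C b)

/-- fractions of elements of `A`. -/
def Scal (ι : Polynomial A →+* L) (x : L) : Prop :=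
  ∃ (p : A) (b : A), b ≠ 0 ∧ x = ι (Polynomial.C p) / ι (Polynomial.C b)

variable {ι : Polynomial A →+* L} (hι : Function.Injective ι) {d : Polynomial A} (hd : Prime d)
  (hdeg : 1 ≤ d.natDegree)
include hι

lemma ine {p : Polynomial A} (h : p ≠ 0) : ι p ≠ 0 := by
  rwa [Ne, map_eq_zero_iff ι hι]

lemma ine' {b : A} (h : b ≠ 0) : ι (Polynomial.C b) ≠ 0 :=
  ine hι (by simpa using h)

omit hι in
lemma ndvd_ne {q : Polynomial A} (h : ¬ d ∣ q) : q ≠ 0 := by rintro rfl; simp at h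

omit hι in
include hdeg in
lemma ndvd_C {b : A} (hb : b ≠ 0) : ¬ d ∣ Polynomial.C b := by
  intro h
  have := Polynomial.natDegree_le_of_dvd h (by simpa using hb)
  simp at this
  omega

include hd in
lemma Loc.add {x y : L} (hx : Loc ι d x) (hy : Loc ι d y) : Loc ι d (x + y) := by
  obtain ⟨p, q, h, rfl⟩ := hx
  obtain ⟨p', q', h', rfl⟩ := hy
  refine ⟨p * q' + q * p', q * q', fun hh => (hd.dvd_or_dvd hh).elim h h', ?_⟩
  rw [div_add_div _ _ (ine hι (ndvd_ne h)) (ine hι (ndvd_ne h'))]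
  simp

omit hι in
include hd in
lemma Loc.mul {x y : L} (hx : Loc ι d x) (hy : Loc ι d y) : Loc ι d (x * y) := by
  obtain ⟨p, q, h, rfl⟩ := hx
  obtain ⟨p', q', h', rfl⟩ := hy
  refine ⟨p * p', q * q', fun hh => (hd.dvd_or_dvd hh).elim h h', ?_⟩
  rw [div_mul_div_comm]
  simp

omit hι in
include hd in
lemma Loc.of (p : Polynomial A) : Loc ι d (ι p) :=
  ⟨p, 1, fun h => hd.not_isUnit (isUnit_of_dvd_one h), by simp⟩

omit hι in
include hd in
lemma Loc.neg {x : L} (hx : Loc ι d x) : Loc ι d (-x) := by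
  have := Loc.mul hd (Loc.of (ι := ι) hd (-1)) hx
  simpa using this

omit hι in
include hd in
lemma Loc.pow {x : L} (hx : Loc ι d x) (m : ℕ) : Loc ι d (x ^ m) := by
  induction m with
  | zero => simpa using Loc.of (ι := ι) hd 1
  | succ m ih => rw [pow_succ]; exact ih.mul hd hx

include hd in
lemma Loc.sum {β : Type*} {s : Finset β} {f : β → L} (h : ∀ i ∈ s, Loc ι d (f i)) :
    Loc ι d (∑ i ∈ s, f i) := by
  classical
  induction s using Finset.induction_on with
  | empty => simpa using Loc.of (ι := ι) hd 0
  | insert a s ha ih =>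
    rw [Finset.sum_insert ha]
    exact Loc.add hι hd (h a (by simp)) (ih fun i hi => h i (by simp [hi]))

omit hι in
include hdeg in
lemma Low.loc {x : L} (hx : Low ι d x) : Loc ι d x := by
  obtain ⟨p, b, hb, -, rfl⟩ := hx
  exact ⟨p, _, ndvd_C hdeg hb, rfl⟩

omit hι in
include hdeg in
lemma Scal.loc {x : L} (hx : Scal ι x) : Loc ι d x := by
  obtain ⟨p, b, hb, rfl⟩ := hx
  exact ⟨_, _, ndvd_C hdeg hb, rfl⟩

lemma Low.add {x y : L} (hx : Low ι d x) (hy : Low ι d y) : Low ι d (x + y) := by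
  obtain ⟨p, b, hb, h, rfl⟩ := hx
  obtain ⟨p', b', hb', h', rfl⟩ := hy
  refine ⟨p * Polynomial.C b' + Polynomial.C b * p', b * b', mul_ne_zero hb hb', ?_, ?_⟩
  · refine lt_of_le_of_lt (Polynomial.natDegree_add_le _ _) (max_lt ?_ ?_)
    · exact lt_of_le_of_lt (Polynomial.natDegree_mul_C_le _ _) h
    · exact lt_of_le_of_lt (Polynomial.natDegree_C_mul_le _ _) h'
  · rw [div_add_div _ _ (ine' hι hb) (ine' hι hb')]
    simp

omit hι in
lemma Low.smul {x e : L} (he : Scal ι e) (hx : Low ι d x) : Low ι d (e * x) := by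
  obtain ⟨p, b, hb, h, rfl⟩ := hx
  obtain ⟨p', b', hb', rfl⟩ := he
  refine ⟨Polynomial.C p' * p, b' * b, mul_ne_zero hb' hb, ?_, ?_⟩
  · exact lt_of_le_of_lt (Polynomial.natDegree_C_mul_le _ _) h
  · rw [div_mul_div_comm]
    simp

omit hι in
lemma Scal.neg_one : Scal ι (-1) := ⟨-1, 1, one_ne_zero, by simp⟩

lemma Low.sub {x y : L} (hx : Low ι d x) (hy : Low ι d y) : Low ι d (x - y) := by
  have := hx.add hι (hy.smul Scal.neg_one)
  rwa [neg_one_mul, ← sub_eq_add_neg] at this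

omit hι in
include hdeg in
lemma Low.zero : Low ι d 0 := ⟨0, 1, one_ne_zero, by rw [Polynomial.natDegree_zero]; omega, by simp⟩

include hd hdeg in
lemma low_eq_zero {x y : L} (hx : Low ι d x) (hy : Loc ι d y) (h : x = ι d * y) : x = 0 := by
  obtain ⟨p, b, hb, hp, rfl⟩ := hx
  obtain ⟨p', q, hq, rfl⟩ := hy
  have h1 := ine' hι hb
  have h2 := ine hι (ndvd_ne hq)
  have h3 : p * q = d * (p' * Polynomial.C b) := by
    apply hι
    field_simp at h
    simp only [map_mul]
    linear_combination h
  have h4 : d ∣ p := (hd.dvd_or_dvd ⟨_, h3⟩).resolve_right hq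
  have h5 : p = 0 := Polynomial.eq_zero_of_dvd_of_natDegree_lt h4 hp
  simp [h5]

include hd hdeg in
lemma loc_split {x : L} (hx : Loc ι d x) : ∃ s y, Low ι d s ∧ Loc ι d y ∧ x = s + ι d * y := by
  obtain ⟨p, q, hq, rfl⟩ := hx
  obtain ⟨b, r, s, hb, e⟩ := bezoutConst d hd hdeg q hq
  obtain ⟨b', Q, S, hb', hS, e'⟩ := pseudoDiv d hdeg _ (p * r) (Nat.lt_succ_self _)
  have h1 := ine' hι hb
  have h1' := ine' hι hb'
  have h2 := ine hι (ndvd_ne hq)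
  refine ⟨ι S / ι (Polynomial.C (b' * b)), ι (Q * q + Polynomial.C b' * p * s) /
    ι (Polynomial.C (b' * b) * q), ⟨S, _, mul_ne_zero hb' hb, hS, rfl⟩,
    ⟨_, _, fun h => (hd.dvd_or_dvd h).elim (ndvd_C hdeg (mul_ne_zero hb' hb)) hq, rfl⟩, ?_⟩
  have e1 := congrArg ι e
  have e2 := congrArg ι e'
  simp only [map_mul, map_add] at e1 e2 ⊢
  field_simp
  rw [e1]
  linear_combination (ι q) * e2

include hd hdeg in
lemma expand (N : ℕ) : ∀ g : L, Loc ι d (ι d ^ N * g) → ∃ (s : ℕ → L) (y : L),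
    (∀ i, Low ι d (s i)) ∧ Loc ι d y ∧ g = ∑ i ∈ Finset.range N, s i / ι d ^ (i + 1) + y := by
  have h0 := ine hι hd.ne_zero
  induction N with
  | zero => intro g hg; exact ⟨fun _ => 0, g, fun _ => Low.zero hdeg, by simpa using hg, by simp⟩
  | succ N ih =>
    intro g hg
    obtain ⟨t, y, ht, hy, e⟩ := loc_split hι hd hdeg hg
    obtain ⟨s, z, hs, hz, e'⟩ := ih (g - t / ι d ^ (N + 1)) (by
      have : ι d ^ N * (g - t / ι d ^ (N + 1)) = y := by
        have h3 : ι d ^ (N + 1) * (t / ι d ^ (N + 1)) = t := by field_simp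
        apply mul_left_cancel₀ h0
        rw [pow_succ] at e h3 ⊢
        linear_combination e - h3
      rwa [this])
    refine ⟨fun i => if i = N then t else s i, z, ?_, hz, ?_⟩
    · intro i; dsimp only; split_ifs; exacts [ht, hs i]
    · beta_reduce
      rw [Finset.sum_range_succ, if_pos rfl, Finset.sum_congr rfl
        (g := fun i => s i / ι d ^ (i + 1)) (fun i hi => by
          rw [if_neg (Finset.mem_range.1 hi).ne])]
      linear_combination e'

include hd hdeg in
lemma expand_unique (N : ℕ) (s : ℕ → L) (y : L) (hs : ∀ i, Low ι d (s i)) (hy : Loc ι d y)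
    (h : ∑ i ∈ Finset.range N, s i / ι d ^ (i + 1) + y = 0) : ∀ i < N, s i = 0 := by
  have h0 := ine hι hd.ne_zero
  induction N with
  | zero => intro i hi; omega
  | succ N ih =>
    have hN : s N = 0 := by
      refine low_eq_zero hι hd hdeg (hs N)
        (y := - (∑ i ∈ Finset.range N, s i * ι d ^ (N - 1 - i) + ι d ^ N * y)) ?_ ?_
      · refine Loc.neg hd (Loc.add hι hd (Loc.sum hι hd fun i _ => ?_) ?_)
        · exact ((hs i).loc hdeg).mul hd ((Loc.of hd d).pow hd _)
        · exact ((Loc.of hd d).pow hd _).mul hd hy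
      · rw [Finset.sum_range_succ] at h
        have h1 : ι d ^ (N + 1) * ∑ i ∈ Finset.range N, s i / ι d ^ (i + 1) =
            ι d * ∑ i ∈ Finset.range N, s i * ι d ^ (N - 1 - i) := by
          rw [Finset.mul_sum, Finset.mul_sum]
          refine Finset.sum_congr rfl fun i hi => ?_
          have hi := Finset.mem_range.1 hi
          have : ι d ^ (N + 1) = ι d ^ (N - 1 - i) * ι d ^ (i + 1) * ι d := by
            rw [← pow_add, ← pow_succ]; congr 1; omega
          rw [this]
          field_simp
        have h2 : ι d ^ (N + 1) * (s N / ι d ^ (N + 1)) = s N := by field_simp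
        rw [pow_succ] at h1 h2
        rw [pow_succ] at h
        linear_combination ι d ^ N * ι d * h - h1 - h2
    intro i hi
    rcases Nat.lt_succ_iff_lt_or_eq.1 hi with hi | rfl
    · refine ih ?_ i hi
      rw [Finset.sum_range_succ, hN] at h
      simpa using h
    · exact hN

include hd hdeg in
lemma core (hsurj : ∀ g : L, ∃ p q, q ≠ 0 ∧ g = ι p / ι q)
    (hfin : ∀ q : Polynomial A, q ≠ 0 → FiniteMultiplicity d q)
    (τ : L →+* L) (hτlow : ∀ x, Low ι d x → Low ι d (τ x)) (hτloc : ∀ x, Loc ι d x → Loc ι d (τ x))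
    (u c : L) (hu0 : u ≠ 0) (hu : ∀ m : ℕ, Scal ι (c / u ^ m)) (hc : Scal ι c)
    (hτd : τ (ι d) = u * ι d)
    (j : ℕ) (a x g : L) (ha : Low ι d a) (hx : Loc ι d x)
    (h : a / ι d ^ (j + 1) + x = c * τ g - g) :
    ∃ b, Low ι d b ∧ a = c / u ^ (j + 1) * τ b - b := by
  have h0 := ine hι hd.ne_zero
  obtain ⟨p, q, hq, hg⟩ := hsurj g
  obtain ⟨M, hM⟩ : ∃ M, M = multiplicity d q := ⟨_, rfl⟩
  obtain ⟨q', hq', hnd⟩ := (hfin q hq).exists_eq_pow_mul_and_not_dvd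
  rw [← hM] at hq'
  have hq'0 := ine hι (ndvd_ne hnd)
  obtain ⟨N, hN⟩ : ∃ N, N = M + (j + 1) := ⟨_, rfl⟩
  obtain ⟨s, y, hs, hy, e⟩ := expand hι hd hdeg N g ⟨d ^ (j + 1) * p, q', hnd, by
    rw [hg, hq', hN]; simp only [map_mul, map_pow]; field_simp; ring⟩
  have hcl : Loc ι d c := hc.loc hdeg
  have key := expand_unique hι hd hdeg N
    (fun i => c / u ^ (i + 1) * τ (s i) - s i - (if i = j then a else 0))
    (c * τ y - y - x) (fun i => by
      refine Low.sub hι (Low.sub hι (Low.smul (hu _) (hτlow _ (hs i))) (hs i)) ?_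
      split_ifs
      exacts [ha, Low.zero hdeg]) (by
      rw [sub_eq_add_neg, sub_eq_add_neg]
      exact Loc.add hι hd (Loc.add hι hd (hcl.mul hd (hτloc _ hy)) (hy.neg hd)) (hx.neg hd)) (by
      have e1 : ∑ i ∈ Finset.range N, (if i = j then a else 0) / ι d ^ (i + 1)
          = a / ι d ^ (j + 1) := by
        rw [Finset.sum_eq_single j]
        · simp
        · intro b _ hb; simp [hb]
        · intro hj; simp only [Finset.mem_range] at hj; omega
      have e2 : c * τ g = ∑ i ∈ Finset.range N, (c / u ^ (i + 1) * τ (s i)) / ι d ^ (i + 1)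
          + c * τ y := by
        rw [e, map_add, mul_add, map_sum, Finset.mul_sum]
        congr 1
        refine Finset.sum_congr rfl fun i _ => ?_
        rw [map_div₀, map_pow, hτd, mul_pow]
        field_simp
      simp only [sub_div, Finset.sum_sub_distrib]
      rw [e1]
      linear_combination e - e2 - h) j (by omega)
  refine ⟨s j, hs j, ?_⟩
  simp only [if_true] at key
  linear_combination -key

end Generic

section Concrete

variable {F : Type*} [Field F] {n : ℕ}

/-- Polynomials in the last variable. -/
noncomputable def EE (F : Type*) [Field F] (n : ℕ) :
    MvPolynomial (Fin (n + 1)) F ≃ₐ[F] Polynomial (MvPolynomial (Fin n) F) :=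
  (renameEquiv F (finSuccEquivLast (n := n))).trans (optionEquivLeft F (Fin n))

lemma EE_last : EE F n (X (Fin.last n)) = Polynomial.X := by
  simp [EE]

lemma EE_castSucc (t : Fin n) : EE F n (X t.castSucc) = Polynomial.C (X t) := by
  simp [EE]

lemma EE_C (e : F) : EE F n (C e) = Polynomial.C (C e) := by
  simp [EE]

lemma EE_deg (d : MvPolynomial (Fin (n + 1)) F) :
    (EE F n d).natDegree = d.degreeOf (Fin.last n) := by
  simp only [EE, AlgEquiv.trans_apply, natDegree_optionEquivLeft, renameEquiv_apply]
  rw [← finSuccEquivLast_last]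
  exact degreeOf_rename_of_injective (Equiv.injective _) _

/-- The embedding into the fraction field. -/
noncomputable def io (F : Type*) [Field F] (n : ℕ) :
    Polynomial (MvPolynomial (Fin n) F) →+* K F (n + 1) :=
  (algebraMap (MvPolynomial (Fin (n + 1)) F) (K F (n + 1))).comp
    ((EE F n).symm : Polynomial (MvPolynomial (Fin n) F) →+* MvPolynomial (Fin (n + 1)) F)

lemma io_EE (p : MvPolynomial (Fin (n + 1)) F) :
    io F n (EE F n p) = algebraMap (MvPolynomial (Fin (n + 1)) F) (K F (n + 1)) p := by
  simp [io]

lemma io_inj : Function.Injective (io F n) :=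
  (IsFractionRing.injective (MvPolynomial (Fin (n + 1)) F) (K F (n + 1))).comp
    (EE F n).symm.injective

lemma io_X : io F n Polynomial.X = α (Fin.last n) := by
  rw [← EE_last, io_EE]; rfl

lemma io_CX (t : Fin n) : io F n (Polynomial.C (X t)) = α t.castSucc := by
  rw [← EE_castSucc, io_EE]; rfl

lemma io_CC (e : F) : io F n (Polynomial.C (C e)) = algebraMap F (K F (n + 1)) e := by
  rw [← EE_C, io_EE, ← MvPolynomial.algebraMap_eq]
  exact (IsScalarTower.algebraMap_apply F (MvPolynomial (Fin (n + 1)) F) (K F (n + 1)) e).symm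

lemma io_surj (g : K F (n + 1)) : ∃ p q, q ≠ 0 ∧ g = io F n p / io F n q := by
  obtain ⟨p, q, hq, rfl⟩ := IsFractionRing.div_surjective (A := MvPolynomial (Fin (n + 1)) F) g
  exact ⟨EE F n p, EE F n q, by simpa using nonZeroDivisors.ne_zero hq, by rw [io_EE, io_EE]⟩

lemma algMap_mem (e : F) : algebraMap F (K F (n + 1)) e ∈ Fprime F n :=
  Subfield.subset_closure (Or.inl ⟨e, rfl⟩)

lemma io_C_mem (a : MvPolynomial (Fin n) F) : io F n (Polynomial.C a) ∈ Fprime F n := by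
  induction a using MvPolynomial.induction_on with
  | C e => rw [io_CC]; exact algMap_mem e
  | add p q hp hq => rw [map_add, map_add]; exact add_mem hp hq
  | mul_X p t hp =>
    rw [map_mul, map_mul, io_CX]
    exact mul_mem hp (Subfield.subset_closure (Or.inr ⟨t, rfl⟩))

lemma scal_iff (x : K F (n + 1)) : Scal (io F n) x ↔ x ∈ Fprime F n := by
  constructor
  · rintro ⟨p, b, -, rfl⟩
    exact div_mem (io_C_mem p) (io_C_mem b)
  · intro h
    have key : ∀ p : MvPolynomial (Fin n) F, Scal (io F n) (io F n (Polynomial.C p)) :=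
      fun p => ⟨p, 1, one_ne_zero, by simp⟩
    induction h using Subfield.closure_induction with
    | mem x hx =>
      rcases hx with ⟨e, rfl⟩ | ⟨t, rfl⟩
      · rw [← io_CC]; exact key _
      · beta_reduce; rw [← io_CX]; exact key _
    | one => simpa using key 1
    | add x y _ _ hx hy =>
      obtain ⟨p, b, hb, rfl⟩ := hx
      obtain ⟨p', b', hb', rfl⟩ := hy
      refine ⟨p * b' + b * p', b * b', mul_ne_zero hb hb', ?_⟩
      rw [div_add_div _ _ (ine' io_inj hb) (ine' io_inj hb')]
      simp
    | neg x _ hx =>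
      obtain ⟨p, b, hb, rfl⟩ := hx
      exact ⟨-p, b, hb, by simp [neg_div]⟩
    | inv x _ hx =>
      obtain ⟨p, b, hb, rfl⟩ := hx
      by_cases hp : p = 0
      · subst hp; simpa using key 0
      · exact ⟨b, p, hp, by rw [inv_div]⟩
    | mul x y _ _ hx hy =>
      obtain ⟨p, b, hb, rfl⟩ := hx
      obtain ⟨p', b', hb', rfl⟩ := hy
      refine ⟨p * p', b * b', mul_ne_zero hb hb', ?_⟩
      rw [div_mul_div_comm]
      simp

lemma low_iff (d : MvPolynomial (Fin (n + 1)) F) (hdeg : 1 ≤ d.degreeOf (Fin.last n))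
    (x : K F (n + 1)) : Low (io F n) (EE F n d) x ↔
    ∃ bC : ℕ → K F (n + 1), (∀ t, bC t ∈ Fprime F n) ∧
      x = ∑ t ∈ Finset.range (d.degreeOf (Fin.last n)),
        bC t * (α (Fin.last n) : K F (n + 1)) ^ t := by
  constructor
  · rintro ⟨p, b, hb, hp, rfl⟩
    rw [EE_deg] at hp
    refine ⟨fun t => io F n (Polynomial.C (p.coeff t)) / io F n (Polynomial.C b),
      fun t => div_mem (io_C_mem _) (io_C_mem _), ?_⟩
    conv_lhs => rw [p.as_sum_range_C_mul_X_pow' hp]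
    rw [map_sum, Finset.sum_div]
    refine Finset.sum_congr rfl fun t _ => ?_
    rw [map_mul, map_pow, io_X]
    ring
  · rintro ⟨bC, hb, rfl⟩
    have hz : Low (io F n) (EE F n d) 0 := Low.zero (by rwa [EE_deg])
    have : ∀ N ≤ d.degreeOf (Fin.last n), Low (io F n) (EE F n d)
        (∑ t ∈ Finset.range N, bC t * (α (Fin.last n) : K F (n + 1)) ^ t) := by
      intro N
      induction N with
      | zero => intro _; simpa using hz
      | succ N ih =>
        intro hN
        rw [Finset.sum_range_succ]
        refine Low.add io_inj (ih (by omega)) (Low.smul ((scal_iff _).2 (hb N)) ?_)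
        refine ⟨Polynomial.X ^ N, 1, one_ne_zero, ?_, ?_⟩
        · rw [Polynomial.natDegree_X_pow, EE_deg]; omega
        · rw [map_pow, io_X]; simp
    exact this _ le_rfl

lemma exists_lift (lam : Fin (n + 1) → F) (hlam : ∀ i, lam i ≠ 0)
    (σ : K F (n + 1) ≃ₐ[F] K F (n + 1))
    (hσ : ∀ i, σ (α i) = algebraMap F (K F (n + 1)) (lam i) * α i) :
    ∃ s : MvPolynomial (Fin (n + 1)) F ≃ₐ[F] MvPolynomial (Fin (n + 1)) F,
      ∀ p, σ (algebraMap (MvPolynomial (Fin (n + 1)) F) (K F (n + 1)) p) =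
        algebraMap (MvPolynomial (Fin (n + 1)) F) (K F (n + 1)) (s p) := by
  refine ⟨AlgEquiv.ofAlgHom (aeval fun i => C (lam i) * X i) (aeval fun i => C (lam i)⁻¹ * X i)
    ?_ ?_, ?_⟩
  · ext1 i
    simp only [AlgHom.comp_apply, aeval_X, map_mul, algHom_C, AlgHom.id_apply, algebraMap_eq]
    rw [← mul_assoc, ← C_mul, inv_mul_cancel₀ (hlam i), C_1, one_mul]
  · ext1 i
    simp only [AlgHom.comp_apply, aeval_X, map_mul, algHom_C, AlgHom.id_apply, algebraMap_eq]
    rw [← mul_assoc, ← C_mul, mul_inv_cancel₀ (hlam i), C_1, one_mul]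
  · intro p
    have : (σ : K F (n + 1) →ₐ[F] K F (n + 1)).comp
        (IsScalarTower.toAlgHom F (MvPolynomial (Fin (n + 1)) F) (K F (n + 1))) =
        (IsScalarTower.toAlgHom F (MvPolynomial (Fin (n + 1)) F) (K F (n + 1))).comp
        (aeval fun i => C (lam i) * X i) := by
      ext1 i
      simp only [AlgHom.comp_apply, aeval_X, map_mul, IsScalarTower.coe_toAlgHom']
      refine (hσ i).trans ?_
      rw [← MvPolynomial.algebraMap_eq, ← IsScalarTower.algebraMap_apply]
      rfl
    exact DFunLike.congr_fun this p

lemma sigma_mem (lam : Fin (n + 1) → F)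
    (σ : K F (n + 1) ≃ₐ[F] K F (n + 1))
    (hσ : ∀ i, σ (α i) = algebraMap F (K F (n + 1)) (lam i) * α i) (x : K F (n + 1))
    (hx : x ∈ Fprime F n) : σ x ∈ Fprime F n := by
  have : Fprime F n ≤ (Fprime F n).comap (σ : K F (n + 1) →+* K F (n + 1)) := by
    refine Subfield.closure_le.2 ?_
    rintro y (⟨e, rfl⟩ | ⟨t, rfl⟩)
    · change σ _ ∈ Fprime F n
      rw [AlgEquiv.commutes]; exact algMap_mem e
    · change σ (α _) ∈ Fprime F n
      rw [hσ]
      exact mul_mem (algMap_mem _) (Subfield.subset_closure (Or.inr ⟨t, rfl⟩))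
  exact this hx

lemma sigma_low (lam : Fin (n + 1) → F)
    (σ : K F (n + 1) ≃ₐ[F] K F (n + 1))
    (hσ : ∀ i, σ (α i) = algebraMap F (K F (n + 1)) (lam i) * α i)
    (d : MvPolynomial (Fin (n + 1)) F) (hdeg : 1 ≤ d.degreeOf (Fin.last n)) (x : K F (n + 1))
    (hx : Low (io F n) (EE F n d) x) : Low (io F n) (EE F n d) (σ x) := by
  rw [low_iff d hdeg] at hx ⊢
  obtain ⟨bC, hb, rfl⟩ := hx
  refine ⟨fun t => σ (bC t) * algebraMap F (K F (n + 1)) (lam (Fin.last n)) ^ t,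
    fun t => mul_mem (sigma_mem lam σ hσ _ (hb t)) (pow_mem (algMap_mem _) _), ?_⟩
  rw [map_sum]
  refine Finset.sum_congr rfl fun t _ => ?_
  rw [map_mul, map_pow, hσ]
  ring

lemma sigma_pow (lam : Fin (n + 1) → F)
    (σ : K F (n + 1) ≃ₐ[F] K F (n + 1))
    (hσ : ∀ i, σ (α i) = algebraMap F (K F (n + 1)) (lam i) * α i) (m : ℕ) (i : Fin (n + 1)) :
    (σ ^ m) (α i) = algebraMap F (K F (n + 1)) (lam i ^ m) * α i := by
  induction m with
  | zero => simp
  | succ m ih =>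
    rw [pow_succ', AlgEquiv.mul_apply, ih, map_mul, AlgEquiv.commutes, hσ, pow_succ, map_mul]
    ring

lemma algMap_C (e : F) : algebraMap (MvPolynomial (Fin (n + 1)) F) (K F (n + 1)) (C e) =
    algebraMap F (K F (n + 1)) e := by
  rw [← io_EE, EE_C, io_CC]

lemma sigma_loc (σ : K F (n + 1) ≃ₐ[F] K F (n + 1))
    (s : MvPolynomial (Fin (n + 1)) F ≃ₐ[F] MvPolynomial (Fin (n + 1)) F)
    (hs : ∀ p, σ (algebraMap (MvPolynomial (Fin (n + 1)) F) (K F (n + 1)) p) =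
        algebraMap (MvPolynomial (Fin (n + 1)) F) (K F (n + 1)) (s p))
    (d : MvPolynomial (Fin (n + 1)) F) (u : F) (hu : u ≠ 0)
    (hd : σ (algebraMap (MvPolynomial (Fin (n + 1)) F) (K F (n + 1)) d) =
        algebraMap F (K F (n + 1)) u *
          algebraMap (MvPolynomial (Fin (n + 1)) F) (K F (n + 1)) d)
    (x : K F (n + 1)) (hx : Loc (io F n) (EE F n d) x) : Loc (io F n) (EE F n d) (σ x) := by
  have hsd : s d = C u * d := by
    apply IsFractionRing.injective (MvPolynomial (Fin (n + 1)) F) (K F (n + 1))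
    rw [← hs, hd, map_mul, algMap_C]
  obtain ⟨p, q, hq, rfl⟩ := hx
  obtain ⟨p, rfl⟩ := (EE F n).surjective p
  obtain ⟨q, rfl⟩ := (EE F n).surjective q
  refine ⟨EE F n (s p), EE F n (s q), ?_, ?_⟩
  · rw [map_dvd_iff (EE F n)] at hq ⊢
    intro h
    apply hq
    rw [← map_dvd_iff s, hsd]
    have hu' : IsUnit (C u : MvPolynomial (Fin (n + 1)) F) := (isUnit_iff_ne_zero.2 hu).map C
    rwa [hu'.mul_left_dvd]
  · rw [map_div₀, io_EE, io_EE, io_EE, io_EE, hs, hs]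

lemma sigma_inv_loc (σ : K F (n + 1) ≃ₐ[F] K F (n + 1))
    (s : MvPolynomial (Fin (n + 1)) F ≃ₐ[F] MvPolynomial (Fin (n + 1)) F)
    (hs : ∀ p, σ (algebraMap (MvPolynomial (Fin (n + 1)) F) (K F (n + 1)) p) =
        algebraMap (MvPolynomial (Fin (n + 1)) F) (K F (n + 1)) (s p))
    (d : MvPolynomial (Fin (n + 1)) F) (hirr : Irreducible d)
    (hd : ¬ ∃ e : F, e ≠ 0 ∧ σ (algebraMap (MvPolynomial (Fin (n + 1)) F) (K F (n + 1)) d) =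
        algebraMap F (K F (n + 1)) e *
          algebraMap (MvPolynomial (Fin (n + 1)) F) (K F (n + 1)) d) :
    Loc (io F n) (EE F n d)
      (σ (algebraMap (MvPolynomial (Fin (n + 1)) F) (K F (n + 1)) d))⁻¹ := by
  refine ⟨1, EE F n (s d), ?_, by rw [io_EE, hs, map_one, one_div]⟩
  rw [map_dvd_iff (EE F n)]
  rintro ⟨r, hr⟩
  have h1 : Irreducible (s d) := (MulEquiv.irreducible_iff s).2 hirr
  have h2 : IsUnit r := (h1.isUnit_or_isUnit hr).resolve_left hirr.not_isUnit
  obtain ⟨e, he, rfl⟩ := MvPolynomial.isUnit_iff_eq_C_of_isReduced.1 h2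
  refine hd ⟨e, he.ne_zero, ?_⟩
  rw [hs, hr, map_mul, algMap_C, mul_comm]

lemma tele1 (σ : K F (n + 1) ≃ₐ[F] K F (n + 1)) (c : K F (n + 1)) (hc : σ c = c)
    (g : K F (n + 1)) (k : ℕ) :
    ∑ i ∈ Finset.range k, c ^ i * (σ ^ i) (c * σ g - g) = c ^ k * (σ ^ k) g - g := by
  have hcc : ∀ k : ℕ, (σ ^ k) c = c := by
    intro k
    induction k with
    | zero => simp
    | succ k ih => rw [pow_succ, AlgEquiv.mul_apply, hc, ih]
  induction k with
  | zero => simp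
  | succ k ih =>
    rw [Finset.sum_range_succ, ih, map_sub, map_mul, hcc, pow_succ σ k, AlgEquiv.mul_apply]
    ring

lemma tele2 (σ : K F (n + 1) ≃ₐ[F] K F (n + 1)) (c : K F (n + 1)) (hc : σ c = c)
    (g : K F (n + 1)) (k : ℕ) :
    c * σ (∑ i ∈ Finset.range k, c ^ i * (σ ^ i) g) - ∑ i ∈ Finset.range k, c ^ i * (σ ^ i) g
      = c ^ k * (σ ^ k) g - g := by
  induction k with
  | zero => simp
  | succ k ih =>
    rw [Finset.sum_range_succ, map_add, map_mul, map_pow, hc, pow_succ' σ k, AlgEquiv.mul_apply]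
    linear_combination ih

end Concrete

set_option maxHeartbeats 1000000 in
/-- Let `n + 1 ≥ 2` be the number of variables and `σ` the `F`-algebra
automorphism of `K = F(α₁,…,α_{n+1})` with `σ(αᵢ) = λᵢ αᵢ` (all `λᵢ` nonzero). Let `d` be an
irreducible polynomial with `deg_{αlast}(d) ≥ 1`, not a scalar multiple of the last
variable, with `Spr_σ(d,d) = kℤ` for some `k ≥ 1` and `σᵏ(d) = u·d` for some `u ∈ F∖{0}`.
Let `j ≥ 1`, `c ∈ F∖{0}`, and let `a = ∑_{t < deg_{αlast}(d)} aC(t)·αlast^t` be a polynomial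
in `αlast` with coefficients in `F'` of degree `< deg_{αlast}(d)`. Set `ε = cᵏ·u^{−j}`.
Then `a/d^j` is `cσ`-summable in `K` iff there is a polynomial
`b = ∑_{t < deg_{αlast}(d)} bC(t)·αlast^t` in `αlast` with coefficients in `F'` of degree
`< deg_{αlast}(d)` such that `a = ε·σᵏ(b) − b`. -/
theorem stmt_12 {F : Type*} [Field F] [Algebra F (AlgebraicClosure ℚ)]
    {n : ℕ} (hn : 1 ≤ n)
    (lam : Fin (n + 1) → F) (hlam : ∀ i, lam i ≠ 0)
    (σ : K F (n + 1) ≃ₐ[F] K F (n + 1))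
    (hσ : ∀ i, σ (α i) = algebraMap F (K F (n + 1)) (lam i) * α i)
    (d : MvPolynomial (Fin (n + 1)) F) (hirr : Irreducible d)
    (hdeg : 1 ≤ d.degreeOf (Fin.last n))
    (hnotX : ¬ ∃ e : F, d = C e * X (Fin.last n))
    (k : ℕ) (hk : 1 ≤ k)
    (hspr : {k' : ℤ | ∃ e : F, e ≠ 0 ∧
        (σ ^ k') (algebraMap (MvPolynomial (Fin (n + 1)) F) (K F (n + 1)) d) =
          algebraMap F (K F (n + 1)) e *
            algebraMap (MvPolynomial (Fin (n + 1)) F) (K F (n + 1)) d}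
      = {k' : ℤ | (k : ℤ) ∣ k'})
    (u : F) (hu : u ≠ 0)
    (hσkd : (σ ^ (k : ℤ)) (algebraMap (MvPolynomial (Fin (n + 1)) F) (K F (n + 1)) d) =
        algebraMap F (K F (n + 1)) u *
          algebraMap (MvPolynomial (Fin (n + 1)) F) (K F (n + 1)) d)
    (j : ℕ) (hj : 1 ≤ j) (c : F) (hc : c ≠ 0)
    (aC : ℕ → K F (n + 1)) (haC : ∀ t, aC t ∈ Fprime F n)
    (a : K F (n + 1))
    (ha : a = ∑ t ∈ Finset.range (d.degreeOf (Fin.last n)),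
        aC t * (α (Fin.last n) : K F (n + 1)) ^ t) :
    (∃ g : K F (n + 1),
        a / (algebraMap (MvPolynomial (Fin (n + 1)) F) (K F (n + 1)) d) ^ j =
          algebraMap F (K F (n + 1)) c * σ g - g) ↔
    (∃ bC : ℕ → K F (n + 1), (∀ t, bC t ∈ Fprime F n) ∧
        a = algebraMap F (K F (n + 1)) (c ^ k / u ^ j) *
              (σ ^ (k : ℤ)) (∑ t ∈ Finset.range (d.degreeOf (Fin.last n)),
                bC t * (α (Fin.last n) : K F (n + 1)) ^ t) -
            (∑ t ∈ Finset.range (d.degreeOf (Fin.last n)),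
                bC t * (α (Fin.last n) : K F (n + 1)) ^ t)) := by
  
  have hinj := IsFractionRing.injective (MvPolynomial (Fin (n + 1)) F) (K F (n + 1))
  have hd0 : algebraMap (MvPolynomial (Fin (n + 1)) F) (K F (n + 1)) d ≠ 0 := by
    rw [Ne, map_eq_zero_iff _ hinj]; exact hirr.ne_zero
  have hu0 : algebraMap F (K F (n + 1)) u ≠ 0 := by simpa using hu
  rw [zpow_natCast] at hσkd ⊢
  constructor
  · rintro ⟨g, hg⟩
    have hprime : Prime (EE F n d) := by
      rw [MulEquiv.prime_iff (EE F n)]; exact hirr.prime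
    have hdeg' : 1 ≤ (EE F n d).natDegree := by rwa [EE_deg]
    have haLow : Low (io F n) (EE F n d) a := (low_iff d hdeg a).2 ⟨aC, haC, ha⟩
    obtain ⟨j, rfl⟩ : ∃ j', j = j' + 1 := ⟨j - 1, by omega⟩
    obtain ⟨k, rfl⟩ : ∃ k', k = k' + 1 := ⟨k - 1, by omega⟩
    have h1 := tele1 σ (algebraMap F (K F (n + 1)) c) (AlgEquiv.commutes _ _) g (k + 1)
    rw [← hg, Finset.sum_range_succ'] at h1
    have hxloc : Loc (io F n) (EE F n d) (∑ i ∈ Finset.range k,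
        algebraMap F (K F (n + 1)) c ^ (i + 1) * (σ ^ (i + 1)) (a /
          (algebraMap (MvPolynomial (Fin (n + 1)) F) (K F (n + 1)) d) ^ (j + 1))) := by
      refine Loc.sum io_inj hprime fun i hi => ?_
      have hi := Finset.mem_range.1 hi
      refine Loc.mul hprime ?_ ?_
      · exact Scal.loc hdeg' ((scal_iff _).2 (pow_mem (algMap_mem _) _))
      · rw [map_div₀, map_pow, div_eq_mul_inv, ← inv_pow]
        refine Loc.mul hprime (Low.loc hdeg' ?_) (Loc.pow hprime ?_ _)
        · exact sigma_low _ _ (sigma_pow lam σ hσ (i + 1)) d hdeg a haLow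
        · obtain ⟨s, hs⟩ := exists_lift _ (fun i' => pow_ne_zero (i + 1) (hlam i')) _
            (sigma_pow lam σ hσ (i + 1))
          refine sigma_inv_loc _ s hs d hirr fun hex => ?_
          have hmem : ((i + 1 : ℕ) : ℤ) ∈ {k' : ℤ | ∃ e : F, e ≠ 0 ∧
              (σ ^ k') (algebraMap (MvPolynomial (Fin (n + 1)) F) (K F (n + 1)) d) =
              algebraMap F (K F (n + 1)) e *
                algebraMap (MvPolynomial (Fin (n + 1)) F) (K F (n + 1)) d} := by
            rw [Set.mem_setOf_eq, zpow_natCast]; exact hex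
          rw [hspr, Set.mem_setOf_eq, Int.natCast_dvd_natCast] at hmem
          have := Nat.le_of_dvd (by omega) hmem
          omega
    obtain ⟨s, hs⟩ := exists_lift _ (fun i' => pow_ne_zero (k + 1) (hlam i')) _
            (sigma_pow lam σ hσ (k + 1))
    obtain ⟨b, hb, hab⟩ := core io_inj hprime hdeg' io_surj
      (fun q hq => FiniteMultiplicity.of_prime_left hprime hq)
      ((σ ^ (k + 1) : K F (n + 1) ≃ₐ[F] K F (n + 1)) : K F (n + 1) →+* K F (n + 1))
      (fun x hx => sigma_low _ _ (sigma_pow lam σ hσ (k + 1)) d hdeg x hx)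
      (fun x hx => sigma_loc _ s hs d u hu hσkd x hx)
      (algebraMap F (K F (n + 1)) u) (algebraMap F (K F (n + 1)) c ^ (k + 1)) hu0
      (fun m => (scal_iff _).2 (div_mem (pow_mem (algMap_mem _) _) (pow_mem (algMap_mem _) _)))
      ((scal_iff _).2 (pow_mem (algMap_mem _) _))
      (by rw [io_EE]; exact hσkd) j a _ g haLow hxloc (by
        rw [io_EE]
        rw [pow_zero, pow_zero, one_mul, AlgEquiv.one_apply] at h1
        exact (add_comm _ _).trans h1)
    obtain ⟨bC, hbC, rfl⟩ := (low_iff d hdeg b).1 hb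
    refine ⟨bC, hbC, ?_⟩
    rw [map_div₀, map_pow, map_pow]
    exact hab
  · rintro ⟨bC, -, hab⟩
    obtain ⟨b, hb⟩ : ∃ b, b = ∑ t ∈ Finset.range (d.degreeOf (Fin.last n)),
                bC t * (α (Fin.last n) : K F (n + 1)) ^ t := ⟨_, rfl⟩
    rw [← hb] at hab
    refine ⟨_, Eq.trans ?_ (tele2 σ (algebraMap F (K F (n + 1)) c) (AlgEquiv.commutes _ _)
      (b / (algebraMap (MvPolynomial (Fin (n + 1)) F) (K F (n + 1)) d) ^ j) k).symm⟩
    rw [hab, map_div₀ (σ ^ k), map_pow (σ ^ k), hσkd, map_div₀, map_pow, map_pow, mul_pow]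
    field_simp
end
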